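/- Let k be a field and R = k[x₁,…,xₙ] with maximal homogeneous ideal m = (x₁,…,xₙ). Let I, J, K be monomial ideals of R with I = J + K, and suppose the set of minimal monomial generators of I is the disjoint union of the sets of minimal monomial generators of J and of K. Then J ∩ K ⊆ m·J and J ∩ K ⊆ m·K. -/

import Mathlib

open MvPolynomial

/-- The maximal homogeneous ideal `m = (x₁,…,xₙ)` of `R = k[x₁,…,xₙ]`. -/
noncomputable def maxIdeal (k : Type*) [Field k] (n : ℕ) :
    Ideal (MvPolynomial (Fin n) k) :=
  Ideal.span (Set.range X)

/-- `u` is a monomial of `R = k[x₁,…,xₙ]`. -/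
def IsMonomial {k : Type*} [Field k] {n : ℕ} (u : MvPolynomial (Fin n) k) : Prop :=
  ∃ d : Fin n →₀ ℕ, u = monomial d 1

/-- `u` is a minimal monomial generator of the monomial ideal `L`:
`u ∈ L` and `u ∉ m·L`. -/
def IsMinGen {k : Type*} [Field k] {n : ℕ} (L : Ideal (MvPolynomial (Fin n) k))
    (u : MvPolynomial (Fin n) k) : Prop :=
  u ∈ L ∧ u ∉ maxIdeal k n * L

theorem monomial_mem_span_of_mem_support {k : Type*} [Field k] {n : ℕ}
    {G : Set (MvPolynomial (Fin n) k)} (hG : ∀ g ∈ G, IsMonomial g)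
    {f : MvPolynomial (Fin n) k} (hf : f ∈ Ideal.span G) {d : Fin n →₀ ℕ} (hd : d ∈ f.support) :
    monomial d (1 : k) ∈ Ideal.span G := by
  have hG' : G = (fun e => monomial e (1 : k)) '' {e | monomial e (1 : k) ∈ G} := by
    ext g
    constructor
    · intro hg
      obtain ⟨e, rfl⟩ := hG g hg
      exact ⟨e, hg, rfl⟩
    · rintro ⟨e, he, rfl⟩
      exact he
  rw [hG'] at hf ⊢
  obtain ⟨e, he, hed⟩ := mem_ideal_span_monomial_image.mp hf d hd
  refine mem_ideal_span_monomial_image.mpr fun d' hd' => ⟨e, he, ?_⟩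
  rwa [Finset.mem_singleton.mp (support_monomial_subset hd')]

theorem mem_of_forall_monomial_mem {k : Type*} [Field k] {n : ℕ}
    {L : Ideal (MvPolynomial (Fin n) k)} {f : MvPolynomial (Fin n) k}
    (h : ∀ d ∈ f.support, monomial d (1 : k) ∈ L) : f ∈ L := by
  rw [f.as_sum]
  refine sum_mem fun d hd => ?_
  rw [← mul_one (f.coeff d), ← C_mul_monomial]
  exact L.mul_mem_left _ (h d hd)

/-- A monomial of `J ∩ K` outside `m·J` would be a minimal generator of `J`, hence of `J + K`,
hence of `K`. -/
theorem inf_le_maxIdeal_mul_left {k : Type*} [Field k] {n : ℕ}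
    {J K : Ideal (MvPolynomial (Fin n) k)}
    (hJ : ∃ G : Set (MvPolynomial (Fin n) k), (∀ g ∈ G, IsMonomial g) ∧ J = Ideal.span G)
    (hK : ∃ G : Set (MvPolynomial (Fin n) k), (∀ g ∈ G, IsMonomial g) ∧ K = Ideal.span G)
    (hgen : ∀ u : MvPolynomial (Fin n) k, IsMonomial u → IsMinGen J u → IsMinGen (J + K) u)
    (hdisj : ∀ u : MvPolynomial (Fin n) k, IsMonomial u → ¬ (IsMinGen J u ∧ IsMinGen K u)) :
    J ⊓ K ≤ maxIdeal k n * J := by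
  obtain ⟨GJ, hGJ, rfl⟩ := hJ
  obtain ⟨GK, hGK, rfl⟩ := hK
  rintro f ⟨hfJ, hfK⟩
  refine mem_of_forall_monomial_mem fun d hd => ?_
  by_contra hmJ
  have huJ : IsMinGen (Ideal.span GJ) (monomial d (1 : k)) :=
    ⟨monomial_mem_span_of_mem_support hGJ hfJ hd, hmJ⟩
  exact hdisj _ ⟨d, rfl⟩ ⟨huJ, monomial_mem_span_of_mem_support hGK hfK hd, fun hmK =>
    (hgen _ ⟨d, rfl⟩ huJ).2 (Ideal.mul_mono_right le_sup_right hmK)⟩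

/-- Let `I, J, K` be monomial ideals of `R = k[x₁,…,xₙ]` with
`I = J + K`, such that the set of minimal monomial generators of `I` is the disjoint
union of those of `J` and of `K`. Then `J ∩ K ⊆ m·J` and `J ∩ K ⊆ m·K`. -/
theorem inter_subset_max_mul (k : Type*) [Field k] (n : ℕ)
    (I J K : Ideal (MvPolynomial (Fin n) k))
    (hI : ∃ G : Set (MvPolynomial (Fin n) k), (∀ g ∈ G, IsMonomial g) ∧ I = Ideal.span G)
    (hJ : ∃ G : Set (MvPolynomial (Fin n) k), (∀ g ∈ G, IsMonomial g) ∧ J = Ideal.span G)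
    (hK : ∃ G : Set (MvPolynomial (Fin n) k), (∀ g ∈ G, IsMonomial g) ∧ K = Ideal.span G)
    (hIJK : I = J + K)
    (hcover : ∀ u : MvPolynomial (Fin n) k, IsMonomial u →
      (IsMinGen I u ↔ IsMinGen J u ∨ IsMinGen K u))
    (hdisj : ∀ u : MvPolynomial (Fin n) k, IsMonomial u →
      ¬ (IsMinGen J u ∧ IsMinGen K u)) :
    J ⊓ K ≤ maxIdeal k n * J ∧ J ⊓ K ≤ maxIdeal k n * K := by
  subst hIJK
  refine ⟨inf_le_maxIdeal_mul_left hJ hK (fun u hu h => (hcover u hu).mpr (.inl h)) hdisj, ?_⟩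
  rw [inf_comm]
  refine inf_le_maxIdeal_mul_left hK hJ (fun u hu h => ?_) fun u hu h => hdisj u hu h.symm
  rw [add_comm]
  exact (hcover u hu).mpr (.inr h)
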